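/- There exist a constant C > 1 and a natural number N such that for every odd n ≥ N the following holds: if G is a simple graph on n vertices with minimum degree δ(G) ≥ n/2 + C, then the cycle space of G equals the span of the edge sets of Hamilton cycles of G; that is, C_n(G) = C(G). -/

import Mathlib

open SimpleGraph

/-- The cycle space of a simple graph: the `ZMod 2`-span of the indicator functions of
edge sets of cycles. -/
noncomputable def cycleSpace {V : Type} [Fintype V] [DecidableEq V] (G : SimpleGraph V) :
    Submodule (ZMod 2) (Sym2 V → ZMod 2) :=
  Submodule.span (ZMod 2)
    {f | ∃ (x : V) (c : G.Walk x x), c.IsCycle ∧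
      f = fun e => if e ∈ c.edges then 1 else 0}

/-- The span of indicator functions of edge sets of Hamilton cycles. -/
noncomputable def hamiltonSpace {V : Type} [Fintype V] [DecidableEq V] (G : SimpleGraph V) :
    Submodule (ZMod 2) (Sym2 V → ZMod 2) :=
  Submodule.span (ZMod 2)
    {f | ∃ (x : V) (c : G.Walk x x), c.IsHamiltonianCycle ∧
      f = fun e => if e ∈ c.edges then 1 else 0}

section HamiltonSpanning

open Finset

variable {V : Type}

/-- The walk visiting `v 0, v 1, …, v m` in this order. -/
def walkOfSeq (G : SimpleGraph V) (v : ℕ → V) :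
    (m : ℕ) → (∀ t < m, G.Adj (v t) (v (t + 1))) → G.Walk (v 0) (v m)
  | 0, _ => .nil
  | m + 1, h => (walkOfSeq G v m fun t ht => h t (by omega)).concat (h m (by omega))

theorem support_walkOfSeq (G : SimpleGraph V) (v : ℕ → V) (m : ℕ)
    (h : ∀ t < m, G.Adj (v t) (v (t + 1))) :
    (walkOfSeq G v m h).support = (List.range (m + 1)).map v := by
  induction m with
  | zero => rfl
  | succ m ih => rw [walkOfSeq, Walk.support_concat, ih, List.range_succ (n := m + 1)]; simp

theorem edges_walkOfSeq (G : SimpleGraph V) (v : ℕ → V) (m : ℕ)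
    (h : ∀ t < m, G.Adj (v t) (v (t + 1))) :
    (walkOfSeq G v m h).edges = (List.range m).map fun t => s(v t, v (t + 1)) := by
  induction m with
  | zero => rfl
  | succ m ih => rw [walkOfSeq, Walk.edges_concat, ih, List.range_succ]; simp

theorem exists_isHamiltonianCycle_of_seq [Fintype V] [DecidableEq V] (G : SimpleGraph V)
    (v : ℕ → V) (hn : 3 ≤ Fintype.card V) (hinj : Set.InjOn v (Set.Iio (Fintype.card V)))
    (hend : v (Fintype.card V) = v 0)
    (h : ∀ t < Fintype.card V, G.Adj (v t) (v (t + 1))) :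
    ∃ c : G.Walk (v 0) (v 0), c.IsHamiltonianCycle ∧
      c.edges = (List.range (Fintype.card V)).map fun t => s(v t, v (t + 1)) := by
  obtain ⟨n, hn'⟩ : ∃ n, Fintype.card V = n := ⟨_, rfl⟩
  rw [hn'] at hn hinj hend h ⊢
  refine ⟨(walkOfSeq G v n h).copy rfl hend, ?_, by rw [Walk.edges_copy, edges_walkOfSeq]⟩
  have hlen : (walkOfSeq G v n h).length = n := by
    rw [← Walk.length_edges, edges_walkOfSeq]; simp
  have hinj' : ∀ s t, s < n → t < n → v s = v t → s = t := fun s t hs ht => hinj.eq_iff hs ht |>.1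
  rw [Walk.isHamiltonianCycle_iff_isCycle_and_length_eq]
  refine ⟨?_, by rw [Walk.length_copy, hlen, hn']⟩
  have hsucc : ∀ s t, s < n → t < n → v (s + 1) = v (t + 1) → s = t := by
    intro s t hs ht hst
    rcases (show s + 1 ≤ n from hs).lt_or_eq with h1 | h1 <;>
      rcases (show t + 1 ≤ n from ht).lt_or_eq with h2 | h2
    · have := hinj' _ _ h1 h2 hst; omega
    · rw [h2, hend] at hst
      have := hinj' _ _ h1 (by omega) hst; omega
    · rw [h1, hend] at hst
      have := hinj' _ _ (by omega) h2 hst; omega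
    · omega
  rw [Walk.isCycle_def, Walk.isTrail_def, Walk.edges_copy, Walk.support_copy, edges_walkOfSeq,
    support_walkOfSeq]
  refine ⟨?_, ?_, ?_⟩
  · refine List.Nodup.map_on ?_ List.nodup_range
    intro s hs t ht hst
    rw [List.mem_range] at hs ht
    rw [Sym2.eq_iff] at hst
    rcases hst with ⟨h1, -⟩ | ⟨h1, h2⟩
    · exact hinj' _ _ hs ht h1
    · exfalso
      rcases (show s + 1 ≤ n from hs).lt_or_eq with hs' | hs' <;>
        rcases (show t + 1 ≤ n from ht).lt_or_eq with ht' | ht'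
      · have := hinj' _ _ hs ht' h1
        have := hinj' _ _ hs' ht h2
        omega
      · rw [ht', hend] at h1
        have := hinj' _ _ hs (by omega) h1
        have := hinj' _ _ hs' ht h2
        omega
      · rw [hs', hend] at h2
        have := hinj' _ _ hs ht' h1
        have := hinj' _ _ (by omega) ht h2
        omega
      · rw [show s = t by omega] at h1
        have := h t ht
        rw [← h1] at this
        exact this.ne rfl
  · intro h0
    have := congrArg Walk.length h0
    rw [Walk.length_copy, hlen] at this
    simp at this
    omega
  · rw [List.range_succ_eq_map, List.map_cons, List.tail_cons, List.map_map]
    refine List.Nodup.map_on ?_ List.nodup_range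
    intro s hs t ht hst
    rw [List.mem_range] at hs ht
    exact hsucc s t hs ht hst

/-- Reversing a segment whose new end pairs are good, and one of whose old end pairs is bad, lowers
the number of bad consecutive pairs. -/
theorem card_filter_gaps_reverse_lt (P : ℕ → ℕ → Prop) (hP : ∀ a b, P a b → P b a)
    [DecidableRel P] (n i j : ℕ) (hij : i < j) (hj : j < n)
    (h₁ : P i j) (h₂ : P (i + 1) (j + 1)) (hgap : ¬ P i (i + 1) ∨ ¬ P j (j + 1))
    (σ : ℕ → ℕ) (hσ : ∀ t, σ t = if i < t ∧ t ≤ j then i + 1 + j - t else t) :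
    #{t ∈ range n | ¬ P (σ t) (σ (t + 1))} < #{t ∈ range n | ¬ P t (t + 1)} := by
  let τ : ℕ → ℕ := fun t => if i < t ∧ t < j then i + j - t else t
  have key : ∀ t < n, ¬ P (σ t) (σ (t + 1)) →
      τ t < n ∧ ¬ P (τ t) (τ t + 1) ∧ τ t ≠ i ∧ τ t ≠ j := by
    intro t ht h
    rcases lt_trichotomy t i with hti | rfl | hti
    · rw [hσ, hσ, if_neg (by omega), if_neg (by omega)] at h
      simp only [τ]
      rw [if_neg (by omega)]
      exact ⟨ht, h, by omega, by omega⟩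
    · rw [hσ, hσ, if_neg (by omega), if_pos (by omega)] at h
      exact absurd h₁ (by convert h using 2; omega)
    · rcases lt_trichotomy t j with htj | rfl | htj
      · rw [hσ, hσ, if_pos (by omega), if_pos (by omega)] at h
        simp only [τ]
        rw [if_pos (by omega)]
        refine ⟨by omega, fun h' => h ?_, by omega, by omega⟩
        convert hP _ _ h' using 1 <;> omega
      · rw [hσ, hσ, if_pos (by omega), if_neg (by omega)] at h
        exact absurd h₂ (by convert h using 2; omega)
      · rw [hσ, hσ, if_neg (by omega), if_neg (by omega)] at h
        simp only [τ]
        rw [if_neg (by omega)]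
        exact ⟨ht, h, by omega, by omega⟩
  have hinj : ∀ s t, τ s = τ t → s = t := by
    intro s t h
    simp only [τ] at h
    split_ifs at h <;> omega
  calc #{t ∈ range n | ¬ P (σ t) (σ (t + 1))}
      = #({t ∈ range n | ¬ P (σ t) (σ (t + 1))}.image τ) :=
        (card_image_of_injective _ hinj).symm
    _ < _ := by
      refine card_lt_card ⟨?_, ?_⟩
      · intro x hx
        simp only [mem_image, mem_filter, mem_range] at hx ⊢
        obtain ⟨t, ⟨ht, h⟩, rfl⟩ := hx
        exact ⟨(key t ht h).1, (key t ht h).2.1⟩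
      · intro hsub
        have : ∀ x, x < n → ¬ P x (x + 1) → x ≠ i ∧ x ≠ j := by
          intro x hx hxP
          have := hsub (mem_filter.2 ⟨mem_range.2 hx, hxP⟩)
          simp only [mem_image, mem_filter, mem_range] at this
          obtain ⟨t, ⟨ht, h⟩, rfl⟩ := this
          exact (key t ht h).2.2
        rcases hgap with h | h
        · exact (this i (by omega) h).1 rfl
        · exact (this j hj h).2 rfl

theorem card_filter_adj_seq [Fintype V] [DecidableEq V] (G : SimpleGraph V) [DecidableRel G.Adj]
    (v : ℕ → V) (hinj : Set.InjOn v (Set.Iio (Fintype.card V))) (u : V) :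
    #{j ∈ range (Fintype.card V) | G.Adj u (v j)} = #(G.neighborFinset u) := by
  have hinj' : Set.InjOn v (range (Fintype.card V) : Finset ℕ) := by simpa using hinj
  have huniv : (range (Fintype.card V)).image v = univ := by
    apply Finset.eq_univ_of_card
    rw [card_image_of_injOn hinj', card_range]
  rw [← card_image_of_injOn (hinj'.mono (coe_subset.2 (filter_subset _ _)))]
  congr 1
  ext x
  simp only [mem_image, mem_filter, mem_neighborFinset]
  constructor
  · rintro ⟨j, ⟨-, h⟩, rfl⟩
    exact h
  · intro h
    obtain ⟨j, hj, rfl⟩ := mem_image.1 (huniv ▸ mem_univ x)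
    exact ⟨j, ⟨hj, h⟩, rfl⟩

/-- A cyclic ordering of the vertices whose first `m` consecutive pairs are edges can be rearranged,
keeping those pairs, so that all consecutive pairs are edges. -/
theorem exists_seq_adj [Fintype V] [DecidableEq V] (G : SimpleGraph V) [DecidableRel G.Adj]
    (m : ℕ)
    (hdeg : ∀ u, Fintype.card V + m < 2 * #(G.neighborFinset u))
    (v : ℕ → V) (hinj : Set.InjOn v (Set.Iio (Fintype.card V)))
    (hend : v (Fintype.card V) = v 0) (hm : ∀ t < m, G.Adj (v t) (v (t + 1))) :
    ∃ w : ℕ → V, Set.InjOn w (Set.Iio (Fintype.card V)) ∧ w (Fintype.card V) = w 0 ∧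
      (∀ t ≤ m, w t = v t) ∧ ∀ t < Fintype.card V, G.Adj (w t) (w (t + 1)) := by
  induction hg : #{t ∈ range (Fintype.card V) | ¬ G.Adj (v t) (v (t + 1))}
    using Nat.strong_induction_on generalizing v with
  | _ g ih =>
  by_cases hall : ∀ t < Fintype.card V, G.Adj (v t) (v (t + 1))
  · exact ⟨v, hinj, hend, fun _ _ => rfl, hall⟩
  push Not at hall
  obtain ⟨i, hi, hgap⟩ := hall
  have hmi : m ≤ i := by
    by_contra h
    exact hgap (hm i (by omega))
  have hinj₁ : Set.InjOn (fun t => v (t + 1)) (Set.Iio (Fintype.card V)) := by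
    intro s hs t ht hst
    simp only [Set.mem_Iio] at hs ht hst
    have hI : ∀ a b, a < Fintype.card V → b < Fintype.card V → v a = v b → a = b :=
      fun a b ha hb => (hinj.eq_iff ha hb).1
    rcases (show s + 1 ≤ Fintype.card V from hs).lt_or_eq with h1 | h1 <;>
      rcases (show t + 1 ≤ Fintype.card V from ht).lt_or_eq with h2 | h2
    · have := hI _ _ h1 h2 hst; omega
    · rw [h2, hend] at hst
      have := hI _ _ h1 (by omega) hst; omega
    · rw [h1, hend] at hst
      have := hI _ _ (by omega) h2 hst; omega
    · omega
  have hA := card_filter_adj_seq G v hinj (v i)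
  have hB := card_filter_adj_seq G _ hinj₁ (v (i + 1))
  obtain ⟨j, hj, hmj, hij, hij'⟩ : ∃ j < Fintype.card V, m ≤ j ∧ G.Adj (v i) (v j) ∧
      G.Adj (v (i + 1)) (v (j + 1)) := by
    by_contra! hcon
    have hle := card_union_add_card_inter
      {j ∈ range (Fintype.card V) | G.Adj (v i) (v j)}
      {j ∈ range (Fintype.card V) | G.Adj (v (i + 1)) (v (j + 1))}
    have h1 : #({j ∈ range (Fintype.card V) | G.Adj (v i) (v j)} ∪
        {j ∈ range (Fintype.card V) | G.Adj (v (i + 1)) (v (j + 1))}) ≤ Fintype.card V := by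
      rw [← card_range (Fintype.card V)]
      refine card_le_card (union_subset ?_ ?_) <;> simp [filter_subset]
    have h2 : #({j ∈ range (Fintype.card V) | G.Adj (v i) (v j)} ∩
        {j ∈ range (Fintype.card V) | G.Adj (v (i + 1)) (v (j + 1))}) ≤ m := by
      conv_rhs => rw [← card_range m]
      refine card_le_card fun j hj => ?_
      simp only [mem_inter, mem_filter, mem_range] at hj ⊢
      by_contra hmj
      exact hcon j hj.1.1 (by omega) hj.1.2 hj.2.2
    have h3 := hdeg (v i)
    have h4 := hdeg (v (i + 1))
    omega
  have hne : i ≠ j := by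
    rintro rfl
    exact hij.ne rfl
  obtain ⟨a, b, hma, hab, hb, hab₁, hab₂, hgap'⟩ : ∃ a b, m ≤ a ∧ a < b ∧ b < Fintype.card V ∧
      G.Adj (v a) (v b) ∧ G.Adj (v (a + 1)) (v (b + 1)) ∧
      (¬ G.Adj (v a) (v (a + 1)) ∨ ¬ G.Adj (v b) (v (b + 1))) := by
    rcases lt_or_gt_of_ne hne with h | h
    · exact ⟨i, j, hmi, h, hj, hij, hij', .inl hgap⟩
    · exact ⟨j, i, hmj, h, hi, hij.symm, hij'.symm, .inr hgap⟩
  let σ : ℕ → ℕ := fun t => if a < t ∧ t ≤ b then a + 1 + b - t else t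
  have hlt := card_filter_gaps_reverse_lt (fun s t => G.Adj (v s) (v t)) (fun _ _ h => h.symm)
    (Fintype.card V) a b hab hb hab₁ hab₂ hgap' σ (fun _ => rfl)
  have hσm : ∀ t ≤ m, σ t = t := fun t ht => if_neg (by omega)
  have hσinj : Set.InjOn (fun t => v (σ t)) (Set.Iio (Fintype.card V)) := by
    intro s hs t ht hst
    simp only [Set.mem_Iio] at hs ht
    have := hinj (x₁ := σ s) (x₂ := σ t) (by simp only [Set.mem_Iio, σ]; split_ifs <;> omega)
      (by simp only [Set.mem_Iio, σ]; split_ifs <;> omega) hst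
    simp only [σ] at this
    split_ifs at this <;> omega
  obtain ⟨w, hw, hw', hwm, hadj⟩ := ih _ (hg ▸ hlt) (fun t => v (σ t)) hσinj
    (by rw [hσm 0 (by omega), ← hend]; congr 1; exact if_neg (by omega))
    (fun t ht => by
      simp only [hσm t (by omega), hσm (t + 1) (by omega)]
      exact hm t ht) rfl
  exact ⟨w, hw, hw', fun t ht => by rw [hwm t ht, hσm t ht], hadj⟩

theorem exists_seq_of_nodup [Fintype V] [DecidableEq V] (p : List V) (hp : p.Nodup) (a : V)
    (hpos : p ≠ []) :
    ∃ v : ℕ → V, Set.InjOn v (Set.Iio (Fintype.card V)) ∧ v (Fintype.card V) = v 0 ∧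
      ∀ t < p.length, v t = p.getD t a := by
  let L := p ++ (univ.filter (· ∉ p)).toList
  have hL : L.Nodup := by
    refine List.Nodup.append hp (Finset.nodup_toList _) ?_
    intro x hx
    simp [hx]
  have hlen : L.length = Fintype.card V := by
    rw [← List.toFinset_card_of_nodup hL, ← Finset.card_univ]
    congr 1
    ext x
    simp [L, em]
  have hle : p.length ≤ Fintype.card V := by
    rw [← hlen]
    simp [L]
  have hp0 := List.length_pos_of_ne_nil hpos
  refine ⟨fun t => L.getD (t % Fintype.card V) a, ?_, ?_, ?_⟩
  · intro s hs t ht hst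
    simp only [Set.mem_Iio] at hs ht
    simp only [Nat.mod_eq_of_lt hs, Nat.mod_eq_of_lt ht] at hst
    rw [List.getD_eq_getElem _ _ (hlen ▸ hs), List.getD_eq_getElem _ _ (hlen ▸ ht)] at hst
    exact (hL.getElem_inj_iff).1 hst
  · simp
  · intro t ht
    simp only [Nat.mod_eq_of_lt (ht.trans_le hle)]
    exact List.getD_append _ _ _ _ ht

/-- If two paths have the same vertex set and the same ends, a functional vanishing on all Hamilton
cycles takes the same value on both. -/
theorem sum_path_eq_of_perm [Fintype V] [DecidableEq V] (G : SimpleGraph V) [DecidableRel G.Adj]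
    (f : Sym2 V → ZMod 2)
    (hf : ∀ (x : V) (c : G.Walk x x), c.IsHamiltonianCycle → (c.edges.map f).sum = 0)
    (m : ℕ) (hm2 : 2 ≤ m) (hdeg : ∀ u, Fintype.card V + m < 2 * #(G.neighborFinset u))
    (p : List V) (hp : p.Nodup) (a : V) (hlen : p.length = m + 1)
    (σ : Equiv.Perm ℕ) (hσ0 : σ 0 = 0) (hσ : ∀ t, m ≤ t → σ t = t)
    (hadj : ∀ t < m, G.Adj (p.getD t a) (p.getD (t + 1) a))
    (hadj' : ∀ t < m, G.Adj (p.getD (σ t) a) (p.getD (σ (t + 1)) a)) :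
    ∑ t ∈ range m, f s(p.getD t a, p.getD (t + 1) a) =
      ∑ t ∈ range m, f s(p.getD (σ t) a, p.getD (σ (t + 1)) a) := by
  have hmn : m < Fintype.card V := by
    have := hp.length_le_card
    omega
  have hσm : ∀ t ≤ m, σ t ≤ m := by
    intro t ht
    by_contra hlt
    have := σ.injective (hσ (σ t) (by omega))
    omega
  have hσn : ∀ t, t < Fintype.card V → σ t < Fintype.card V := by
    intro t ht
    rcases le_or_gt t m with h | h
    · exact (hσm t h).trans_lt hmn
    · rwa [hσ t h.le]
  obtain ⟨v, hinj, hend, hv⟩ := exists_seq_of_nodup p hp a (by rintro rfl; simp at hlen)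
  obtain ⟨w, hwinj, hwend, hwv, hw⟩ := exists_seq_adj G m hdeg v hinj hend
    (fun t ht => by rw [hv t (by omega), hv (t + 1) (by omega)]; exact hadj t ht)
  have hwp : ∀ t ≤ m, w t = p.getD t a := fun t ht => by rw [hwv t ht, hv t (by omega)]
  have hsum : ∀ u : ℕ → V, Set.InjOn u (Set.Iio (Fintype.card V)) →
      u (Fintype.card V) = u 0 → (∀ t < Fintype.card V, G.Adj (u t) (u (t + 1))) →
      ∑ t ∈ range (Fintype.card V), f s(u t, u (t + 1)) = 0 := by
    intro u h1 h2 h3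
    obtain ⟨c, hc, hce⟩ := exists_isHamiltonianCycle_of_seq G u (by omega) h1 h2 h3
    have := hf _ c hc
    rwa [hce, List.map_map, ← List.sum_toFinset _ List.nodup_range, List.toFinset_range] at this
  have hσw := hsum (fun t => w (σ t))
    (fun s hs t ht hst => σ.injective (hwinj (hσn s hs) (hσn t ht) hst))
    (by rw [hσ _ hmn.le, hσ0, hwend])
    (fun t ht => by
      rcases lt_or_ge t m with h | h
      · simp only [hwp _ (hσm t h.le), hwp _ (hσm (t + 1) h)]
        exact hadj' t h
      · simp only [hσ t h, hσ (t + 1) (by omega)]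
        exact hw t ht)
  have hww := hsum w hwinj hwend hw
  rw [← sum_range_add_sum_Ico _ hmn.le] at hσw hww
  have h1 : ∑ t ∈ Ico m (Fintype.card V), f s(w (σ t), w (σ (t + 1))) =
      ∑ t ∈ Ico m (Fintype.card V), f s(w t, w (t + 1)) := by
    refine sum_congr rfl fun t ht => ?_
    rw [mem_Ico] at ht
    rw [hσ t ht.1, hσ (t + 1) (by omega)]
  rw [h1] at hσw
  have h2 := add_right_cancel (hww.trans hσw.symm)
  refine Eq.trans (Eq.trans ?_ h2) ?_ <;> refine sum_congr rfl fun t ht => ?_ <;>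
    rw [mem_range] at ht
  · rw [hwp t ht.le, hwp (t + 1) ht]
  · rw [hwp _ (hσm t ht.le), hwp _ (hσm (t + 1) ht)]

theorem exists_common_neighbor [Fintype V] [DecidableEq V] (G : SimpleGraph V) [DecidableRel G.Adj]
    (m : ℕ) (hdeg : ∀ u, Fintype.card V + m < 2 * #(G.neighborFinset u)) (u w : V) (S : List V)
    (hS : S.length ≤ m) : ∃ x ∉ S, G.Adj u x ∧ G.Adj w x := by
  have h1 := card_union_add_card_inter (G.neighborFinset u) (G.neighborFinset w)
  have h2 := card_le_univ (G.neighborFinset u ∪ G.neighborFinset w)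
  have h3 := hdeg u
  have h4 := hdeg w
  have h5 := S.toFinset_card_le
  obtain ⟨x, hx, hxS⟩ := exists_mem_notMem_of_card_lt_card
    (show #S.toFinset < #(G.neighborFinset u ∩ G.neighborFinset w) by omega)
  simp only [mem_inter, mem_neighborFinset] at hx
  exact ⟨x, fun h => hxS (List.mem_toFinset.2 h), hx⟩

section Functional

variable [Fintype V] [DecidableEq V] (G : SimpleGraph V) [DecidableRel G.Adj] (f : Sym2 V → ZMod 2)
    (hf : ∀ (x : V) (c : G.Walk x x), c.IsHamiltonianCycle → (c.edges.map f).sum = 0)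
    (hdeg : ∀ u, Fintype.card V + 10 < 2 * #(G.neighborFinset u))

include hf hdeg

theorem four_cycle_sum_eq_zero (a b c d : V) (hac : a ≠ c) (hbd : b ≠ d) (hab : G.Adj a b)
    (hbc : G.Adj b c) (hcd : G.Adj c d) (hda : G.Adj d a) :
    f s(a, b) + f s(b, c) + f s(c, d) + f s(d, a) = 0 := by
  obtain ⟨x, hx, hbx, hdx⟩ := exists_common_neighbor G 10 hdeg b d [a, b, c, d] (by simp)
  simp only [List.mem_cons, List.not_mem_nil, or_false, not_or] at hx
  have := sum_path_eq_of_perm G f hf 4 (by norm_num) (fun u => by have := hdeg u; omega)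
    [a, b, x, d, c]
    (by
      have := hab.ne
      have := hbc.ne
      have := hcd.ne
      have := hda.ne
      grind) a rfl (Equiv.swap 1 3) (by decide)
    (fun t ht => Equiv.swap_apply_of_ne_of_ne (by omega) (by omega))
    (fun t ht => by interval_cases t <;> simp [hab, hbx, hdx.symm, hcd.symm])
    (fun t ht => by
      interval_cases t <;> simp [Equiv.swap_apply_def, hda.symm, hbx.symm, hdx, hbc])
  simp [sum_range_succ, Equiv.swap_apply_def] at this
  rw [Sym2.eq_swap (a := d) (b := c), Sym2.eq_swap (a := a) (b := d),
    Sym2.eq_swap (a := d) (b := x), Sym2.eq_swap (a := x) (b := b)] at this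
  grind

theorem six_cycle_sum_eq_zero (a b c d e g : V) (hne : [a, b, c, d, e, g].Nodup)
    (hab : G.Adj a b) (hbc : G.Adj b c) (hcd : G.Adj c d) (hde : G.Adj d e) (heg : G.Adj e g)
    (hga : G.Adj g a) :
    f s(a, b) + f s(b, c) + f s(c, d) + f s(d, e) + f s(e, g) + f s(g, a) = 0 := by
  obtain ⟨x, hx, hbx, hgx⟩ := exists_common_neighbor G 10 hdeg b g [a, b, c, d, e, g] (by simp)
  obtain ⟨y, hy, hcy, hey⟩ := exists_common_neighbor G 10 hdeg c e [a, b, c, d, e, g, x] (by simp)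
  simp only [List.mem_cons, List.not_mem_nil, or_false, not_or] at hx hy
  have := sum_path_eq_of_perm G f hf 7 (by norm_num) (fun u => by have := hdeg u; omega)
    [a, b, x, g, e, y, c, d] (by grind) a rfl (Equiv.swap 1 3 * Equiv.swap 4 6) (by decide)
    (fun t ht => by
      rw [Equiv.Perm.mul_apply, Equiv.swap_apply_of_ne_of_ne (a := 4) (by omega) (by omega),
        Equiv.swap_apply_of_ne_of_ne (by omega) (by omega)])
    (fun t ht => by
      interval_cases t <;> simp [hab, hbx, hgx.symm, heg.symm, hey, hcy.symm, hcd])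
    (fun t ht => by
      interval_cases t <;>
        simp [Equiv.swap_apply_def, hga.symm, hbx.symm, hgx, hbc, hcy, hey.symm, hde.symm])
  simp [sum_range_succ, Equiv.swap_apply_def] at this
  rw [Sym2.eq_swap (a := g) (b := e), Sym2.eq_swap (a := a) (b := g),
    Sym2.eq_swap (a := x) (b := b), Sym2.eq_swap (a := g) (b := x),
    Sym2.eq_swap (a := c) (b := y), Sym2.eq_swap (a := y) (b := e),
    Sym2.eq_swap (a := e) (b := d)] at this
  grind

theorem triangle_sum_eq_of_common_edge (u v x y : V) (huv : G.Adj u v) (hux : G.Adj u x)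
    (hvx : G.Adj v x) (huy : G.Adj u y) (hvy : G.Adj v y) :
    f s(u, v) + f s(v, x) + f s(u, x) = f s(u, v) + f s(v, y) + f s(u, y) := by
  rcases eq_or_ne x y with rfl | hxy
  · rfl
  have := four_cycle_sum_eq_zero G f hf hdeg u x v y huv.ne hxy hux hvx.symm hvy huy.symm
  rw [Sym2.eq_swap (a := x) (b := v), Sym2.eq_swap (a := y) (b := u)] at this
  grind

theorem five_cycle_sum_eq_triangle (a b c d e x : V) (hne : [a, b, c, d, e].Nodup)
    (hab : G.Adj a b) (hbc : G.Adj b c) (hcd : G.Adj c d) (hde : G.Adj d e) (hea : G.Adj e a)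
    (hax : G.Adj a x) (hbx : G.Adj b x) :
    f s(a, b) + f s(b, c) + f s(c, d) + f s(d, e) + f s(e, a) =
      f s(a, b) + f s(b, x) + f s(a, x) := by
  obtain ⟨y, hy, hay, hby⟩ := exists_common_neighbor G 10 hdeg a b [a, b, c, d, e] (by simp)
  rw [triangle_sum_eq_of_common_edge G f hf hdeg a b x y hab hax hbx hay hby]
  have := six_cycle_sum_eq_zero G f hf hdeg a y b c d e (by grind) hay hby.symm hbc hcd hde hea
  rw [Sym2.eq_swap (a := y) (b := b)] at this
  grind

theorem triangle_sum_eq_of_common_vertex (u v w x y : V) (huv : G.Adj u v) (hux : G.Adj u x)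
    (hvx : G.Adj v x) (huw : G.Adj u w) (huy : G.Adj u y) (hwy : G.Adj w y) :
    f s(u, v) + f s(v, x) + f s(u, x) = f s(u, w) + f s(w, y) + f s(u, y) := by
  have key : ∀ v w x y : V, v ≠ w → G.Adj u v → G.Adj u x → G.Adj v x → G.Adj u w →
      G.Adj u y → G.Adj w y →
      f s(u, v) + f s(v, x) + f s(u, x) = f s(u, w) + f s(w, y) + f s(u, y) := by
    intro v w x y hvw huv hux hvx huw huy hwy
    obtain ⟨a, ha, hwa, -⟩ := exists_common_neighbor G 10 hdeg w w [u, v, w] (by simp)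
    obtain ⟨b, hb, hab, hvb⟩ := exists_common_neighbor G 10 hdeg a v [u, v, w, a] (by simp)
    have hne : [u, v, b, a, w].Nodup := by
      have := huv.ne
      have := huw.ne
      grind
    have h1 := five_cycle_sum_eq_triangle G f hf hdeg u v b a w x hne huv hvb hab.symm hwa.symm
      huw.symm hux hvx
    have h2 := five_cycle_sum_eq_triangle G f hf hdeg w u v b a y (by grind) huw.symm huv hvb
      hab.symm hwa.symm hwy huy
    rw [Sym2.eq_swap (a := w) (b := u)] at h1 h2
    grind
  rcases eq_or_ne v w with rfl | hvw
  · exact triangle_sum_eq_of_common_edge G f hf hdeg u v x y huv hux hvx huy hwy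
  · exact key v w x y hvw huv hux hvx huw huy hwy

theorem exists_triangle_sum_eq_const :
    ∃ c : ZMod 2, ∀ u v x : V, G.Adj u v → G.Adj u x → G.Adj v x →
      f s(u, v) + f s(v, x) + f s(u, x) = c := by
  by_cases h : ∃ r s z : V, G.Adj r s ∧ G.Adj r z ∧ G.Adj s z
  · obtain ⟨r, s, z, hrs, hrz, hsz⟩ := h
    refine ⟨f s(r, s) + f s(s, z) + f s(r, z), fun u v x huv hux hvx => ?_⟩
    obtain ⟨a, -, hra, hua⟩ := exists_common_neighbor G 10 hdeg r u [] (by simp)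
    obtain ⟨b, -, hrb, hab⟩ := exists_common_neighbor G 10 hdeg r a [] (by simp)
    obtain ⟨d, -, hud, had⟩ := exists_common_neighbor G 10 hdeg u a [] (by simp)
    have h1 := triangle_sum_eq_of_common_vertex G f hf hdeg r s a z b hrs hrz hsz hra hrb hab
    have h2 := triangle_sum_eq_of_common_vertex G f hf hdeg a r u b d hra.symm hab hrb hua.symm
      had hud
    have h3 := triangle_sum_eq_of_common_vertex G f hf hdeg u a v d x hua hud had huv hux hvx
    rw [Sym2.eq_swap (a := a) (b := r), Sym2.eq_swap (a := a) (b := u)] at h2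
    grind
  · push Not at h
    exact ⟨0, fun u v x huv hux hvx => absurd hvx (h u v x huv hux)⟩

/-- Up to an additive constant, a functional vanishing on Hamilton cycles is a coboundary. -/
theorem exists_potential [Nonempty V] :
    ∃ (c : ZMod 2) (p : V → ZMod 2), ∀ u v : V, G.Adj u v → f s(u, v) = p u + p v + c := by
  obtain ⟨c, hc⟩ := exists_triangle_sum_eq_const G f hf hdeg
  obtain ⟨r⟩ := ‹Nonempty V›
  choose q hq using fun v => exists_common_neighbor G 10 hdeg r v [] (by simp)
  have hq1 := fun v => (hq v).2.1
  have hq2 := fun v => (hq v).2.2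
  have hp : ∀ v x, G.Adj r x → G.Adj v x →
      f s(r, q v) + f s(v, q v) = f s(r, x) + f s(v, x) := by
    intro v x hrx hvx
    rcases eq_or_ne r v with rfl | hrv
    · grind
    rcases eq_or_ne (q v) x with hqx | hqx
    · rw [hqx]
    have := four_cycle_sum_eq_zero G f hf hdeg r (q v) v x hrv hqx (hq1 v) (hq2 v).symm hvx hrx.symm
    rw [Sym2.eq_swap (a := q v) (b := v), Sym2.eq_swap (a := x) (b := r)] at this
    grind
  refine ⟨c, fun v => f s(r, q v) + f s(v, q v), fun u v huv => ?_⟩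
  obtain ⟨x, hx, hrx, hux⟩ := exists_common_neighbor G 10 hdeg r u [r, u, v] (by simp)
  obtain ⟨y, hy, hry, hvy⟩ := exists_common_neighbor G 10 hdeg r v [r, u, v, x] (by simp)
  simp only [hp u x hrx hux, hp v y hry hvy]
  rcases eq_or_ne u r with rfl | hur
  · have := hc u v y huv hry hvy
    grind
  rcases eq_or_ne v r with rfl | hvr
  · have := hc u v x huv hux hrx
    grind
  have hne : [u, v, y, r, x].Nodup := by
    have := huv.ne
    clear hc hp hq1 hq2 hq
    grind
  obtain ⟨z, -, huz, hvz⟩ := exists_common_neighbor G 10 hdeg u v [] (by simp)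
  have h5 := five_cycle_sum_eq_triangle G f hf hdeg u v y r x z hne huv hvy hry.symm hrx
    hux.symm huz hvz
  have := hc u v z huv huz hvz
  rw [Sym2.eq_swap (a := y) (b := r), Sym2.eq_swap (a := x) (b := u)] at h5
  grind

theorem closed_walk_sum_eq_zero (hodd : Odd (Fintype.card V)) (x : V) (w : G.Walk x x) :
    (w.edges.map f).sum = 0 := by
  have : Nonempty V := ⟨x⟩
  obtain ⟨c, p, hp⟩ := exists_potential G f hf hdeg
  have hwalk : ∀ (u v : V) (w : G.Walk u v), (w.edges.map f).sum = p u + p v + w.length * c := by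
    intro u v w
    induction w with
    | nil => simp [CharTwo.add_self_eq_zero]
    | cons h w ih =>
      rw [Walk.edges_cons, List.map_cons, List.sum_cons, ih, hp _ _ h, Walk.length_cons]
      push_cast
      grind
  have hcard : Fintype.card V ≥ 3 := by
    have h1 := hdeg x
    have h2 := card_le_univ (G.neighborFinset x)
    omega
  obtain ⟨v, hinj, hend, -⟩ := exists_seq_of_nodup [x] (List.nodup_singleton x) x (by simp)
  obtain ⟨v, hinj, hend, -, hadj⟩ := exists_seq_adj G 0
    (fun u => by have := hdeg u; omega) v hinj hend (by simp)
  obtain ⟨C, hC, -⟩ := exists_isHamiltonianCycle_of_seq G v hcard hinj hend hadj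
  have h1 := hf _ C hC
  rw [hwalk, hC.length_eq, (ZMod.natCast_eq_one_iff_odd).2 hodd] at h1
  have hc : c = 0 := by grind
  rw [hwalk, hc]
  grind

end Functional

theorem linearMap_indicator_edges {G : SimpleGraph V} [Fintype V] [DecidableEq V]
    (φ : (Sym2 V → ZMod 2) →ₗ[ZMod 2] ZMod 2) {x : V} (c : G.Walk x x) (hc : c.IsCycle) :
    φ (fun e => if e ∈ c.edges then 1 else 0) =
      (c.edges.map fun e => φ (Pi.single e 1)).sum := by
  rw [← List.sum_toFinset _ hc.edges_nodup, ← map_sum]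
  congr 1
  ext e
  simp [Finset.sum_apply, Pi.single_apply]

end HamiltonSpanning

/-- There exist `C > 1` and `N` such that for every odd `n ≥ N`, every graph on `n` vertices
with minimum degree at least `n/2 + C` has its cycle space spanned by Hamilton cycles. -/
theorem dirac_hamilton_space :
    ∃ C : ℝ, C > 1 ∧ ∃ N : ℕ, ∀ n : ℕ, Odd n → n ≥ N →
      ∀ (V : Type) [Fintype V] [DecidableEq V] (G : SimpleGraph V),
        Fintype.card V = n →
        (∀ v : V, ((G.neighborSet v).ncard : ℝ) ≥ n / 2 + C) →
        hamiltonSpace G = cycleSpace G := by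
  refine ⟨6, by norm_num, 0, ?_⟩
  rintro n hodd - V _ _ G rfl hdeg
  classical
  have hdeg' : ∀ u, Fintype.card V + 10 < 2 * (G.neighborFinset u).card := by
    intro u
    have h := hdeg u
    rw [← coe_neighborFinset, Set.ncard_coe_finset] at h
    have : (Fintype.card V : ℝ) + 10 < 2 * (G.neighborFinset u).card := by linarith
    exact_mod_cast this
  apply le_antisymm
  · refine Submodule.span_mono ?_
    rintro f ⟨x, c, hc, rfl⟩
    exact ⟨x, c, hc.isCycle, rfl⟩
  · refine Submodule.span_le.2 ?_
    rintro g ⟨x, c, hc, rfl⟩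
    by_contra hg
    obtain ⟨φ, hφ, hker⟩ := Submodule.exists_le_ker_of_notMem hg
    refine hφ ?_
    rw [linearMap_indicator_edges φ c hc]
    refine closed_walk_sum_eq_zero G (fun e => φ (Pi.single e 1)) ?_ hdeg' hodd x c
    intro y d hd
    rw [← linearMap_indicator_edges φ d hd.isCycle]
    exact hker (Submodule.subset_span ⟨y, d, hd, rfl⟩)
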